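/- arXiv:1302.5808 — 2 statements merged into one kernel-verified Lean document; each statement's English description precedes it below -/
import Mathlib

section
/- Let k ≥ 2 and set τ = (Δ₃σ₄)^{2k}(δ₃σ₄σ₃σ₄)(σ₃σ₄Δ₃)(Δ₃σ₄)^{2k−1}(δ₃σ₄σ₃σ₄) ∈ B₅. Then τ⁻¹ T_k τ = T'_k, where T'_k = (σ₁σ₃)^{2k−2}(σ₃σ₄Δ₃)(Δ₃σ₄)[(δ₃σ₄)(δ̃₃σ₄)]^{k−1}(δ₃σ₄σ₃σ₄). In particular T_k and T'_k are conjugate in B₅. -/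
/-- Defining relations of the braid group on 5 strands, as elements of the
free group on four generators (generator `i` corresponds to `σ_{i+1}`). -/
def braidRels : Set (FreeGroup (Fin 4)) :=
  { r | (∃ i : Fin 3, r = FreeGroup.of i.castSucc * FreeGroup.of i.succ * FreeGroup.of i.castSucc *
          (FreeGroup.of i.succ * FreeGroup.of i.castSucc * FreeGroup.of i.succ)⁻¹) ∨
        (∃ i j : Fin 4, 2 ≤ |(i : ℤ) - (j : ℤ)| ∧
          r = FreeGroup.of i * FreeGroup.of j * (FreeGroup.of j * FreeGroup.of i)⁻¹) }

/-- The Artin braid group on 5 strands. -/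
abbrev B5 : Type := PresentedGroup braidRels

/-- The Artin generators (index `i` corresponds to `σ_{i+1}`). -/
def gen (i : Fin 4) : B5 := PresentedGroup.of i

def s1 : B5 := gen 0
def s2 : B5 := gen 1
def s3 : B5 := gen 2
def s4 : B5 := gen 3

/-- A braid is positive if it lies in the submonoid generated by `σ₁,…,σ₄`. -/
def IsPos (x : B5) : Prop := x ∈ Submonoid.closure (Set.range gen)

/-- Prefix order: `Pre x y` means `x ≼ y`, i.e. `x⁻¹ y` is positive. -/
def Pre (x y : B5) : Prop := IsPos (x⁻¹ * y)

/-- The half twist `Δ = σ₁σ₂σ₃σ₄σ₁σ₂σ₃σ₁σ₂σ₁`. -/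
def Δ : B5 := s1*s2*s3*s4*s1*s2*s3*s1*s2*s1

def δ3 : B5 := s2*s1
def Δ3 : B5 := s2*s1*s2
def δt3 : B5 := s1*s2

/-- A braid `s` is simple if `1 ≼ s ≼ Δ`. -/
def IsSimple (s : B5) : Prop := IsPos s ∧ Pre s Δ

/-- Two simple braids `s, t` are left-weighted if no generator `σᵢ` is such that
`s σᵢ` and `σᵢ⁻¹ t` are both simple. -/
def LeftWeighted (s t : B5) : Prop :=
  ¬ ∃ i : Fin 4, IsSimple (s * gen i) ∧ IsSimple ((gen i)⁻¹ * t)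

/-- The canonical length of `z`: the minimum of `q - p` over `p ≤ q` with
`Δ^p ≼ z` and `z ≼ Δ^q`. -/
noncomputable def canLen (z : B5) : ℕ :=
  sInf { n : ℕ | ∃ p q : ℤ, p ≤ q ∧ q - p = (n : ℤ) ∧ Pre (Δ ^ p) z ∧ Pre z (Δ ^ q) }

/-- `y` belongs to the super summit set of `x`:
`y` is conjugate to `x` and has minimal canonical length among conjugates of `x`. -/
def InSSS (x y : B5) : Prop :=
  IsConj x y ∧ ∀ z : B5, IsConj x z → canLen y ≤ canLen z

/-- The braid `T_k = δ₃^{3k+1} σ₄^{2k+2} σ₃ σ₄^{2k-1}`. -/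
def T (k : ℕ) : B5 := δ3 ^ (3*k+1) * s4 ^ (2*k+2) * s3 * s4 ^ (2*k-1)

/-- The braid `T'_k`, a rigid conjugate of `T_k`. -/
def T' (k : ℕ) : B5 :=
  (s1*s3)^(2*k-2) * (s3*s4*Δ3) * (Δ3*s4) * ((δ3*s4)*(δt3*s4))^(k-1) * (δ3*s4*s3*s4)

theorem s1_s2_braid : s1 * s2 * s1 = s2 * s1 * s2 :=
  PresentedGroup.mk_eq_mk_of_mul_inv_mem (rels := braidRels) (Or.inl ⟨0, rfl⟩)

theorem s3_s4_braid : s3 * s4 * s3 = s4 * s3 * s4 :=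
  PresentedGroup.mk_eq_mk_of_mul_inv_mem (rels := braidRels) (Or.inl ⟨2, rfl⟩)

theorem commute_gen {i j : Fin 4} (h : 2 ≤ |(i : ℤ) - (j : ℤ)|) : Commute (gen i) (gen j) :=
  PresentedGroup.mk_eq_mk_of_mul_inv_mem (rels := braidRels) (Or.inr ⟨i, j, h, rfl⟩)

theorem commute_s1_s3 : Commute s1 s3 := commute_gen (by decide)

theorem commute_s1_s4 : Commute s1 s4 := commute_gen (by decide)

theorem commute_s2_s4 : Commute s2 s4 := commute_gen (by decide)

theorem commute_δ3_s4 : Commute δ3 s4 := commute_s2_s4.mul_left commute_s1_s4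

theorem commute_δt3_s4 : Commute δt3 s4 := commute_s1_s4.mul_left commute_s2_s4

theorem commute_Δ3_s4 : Commute Δ3 s4 := commute_δ3_s4.mul_left commute_s2_s4

theorem s1_mul_Δ3 : s1 * Δ3 = Δ3 * s2 := by
  simp only [Δ3, ← mul_assoc, s1_s2_braid]

theorem s2_mul_Δ3 : s2 * Δ3 = Δ3 * s1 := by
  simp only [Δ3, ← s1_s2_braid, ← mul_assoc]

theorem commute_s1_Δ3_sq : Commute s1 (Δ3 ^ 2) := by
  rw [Commute, SemiconjBy, sq, ← mul_assoc, s1_mul_Δ3, mul_assoc, s2_mul_Δ3, mul_assoc]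

theorem δ3_pow_three : δ3 ^ 3 = Δ3 ^ 2 := by
  have h : δ3 ^ 3 = Δ3 * (s1 * s2 * s1) := by
    simp only [δ3, Δ3, pow_succ, pow_zero, one_mul, mul_assoc]
  rw [h, s1_s2_braid, sq, Δ3]

theorem s1_sq_mul_δ3_mul_δt3 : s1 ^ 2 * (δ3 * δt3) = Δ3 ^ 2 := by
  have h : s1 ^ 2 * (δ3 * δt3) = s1 * (s1 * s2 * s1) * (s1 * s2) := by
    simp only [δ3, δt3, sq, mul_assoc]
  rw [h, s1_s2_braid, ← Δ3, s1_mul_Δ3, sq, mul_assoc, ← mul_assoc s2, ← Δ3]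

theorem commute_s1_sq_δ3_mul_δt3 : Commute (s1 ^ 2) (δ3 * δt3) := by
  have h : δ3 * δt3 = (s1 ^ 2)⁻¹ * Δ3 ^ 2 := by
    rw [← s1_sq_mul_δ3_mul_δt3, inv_mul_cancel_left]
  rw [h]
  exact (Commute.refl _).inv_right.mul_right (commute_s1_Δ3_sq.pow_left 2)

theorem s1_pow_mul_δ3_mul_δt3_pow (n : ℕ) : s1 ^ (2 * n) * (δ3 * δt3) ^ n = Δ3 ^ (2 * n) := by
  rw [pow_mul, ← commute_s1_sq_δ3_mul_δt3.mul_pow, s1_sq_mul_δ3_mul_δt3, pow_mul]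

theorem δ3_mul_s4_mul_δt3_mul_s4_pow (n : ℕ) :
    ((δ3 * s4) * (δt3 * s4)) ^ n = (δ3 * δt3) ^ n * s4 ^ (2 * n) := by
  have h : (δ3 * s4) * (δt3 * s4) = δ3 * δt3 * s4 ^ 2 := by
    rw [mul_assoc, ← mul_assoc s4, ← commute_δt3_s4.eq, sq]
    simp only [mul_assoc]
  rw [h, ((commute_δ3_s4.mul_left commute_δt3_s4).pow_right 2).mul_pow, pow_mul]

/-- Powers of `σ₄` slide through `σ₄σ₃σ₄` and become powers of `σ₃`. -/
theorem s4_pow_mul_s4_s3_s4 (n : ℕ) : s4 ^ n * (δ3 * s4 * s3 * s4) = δ3 * s4 * s3 * s4 * s3 ^ n := by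
  have h : SemiconjBy (s4 * s3 * s4) s3 s4 := by
    rw [SemiconjBy, ← mul_assoc s4, ← mul_assoc s4, mul_assoc _ s4 s3, mul_assoc s4 s3 (s4 * s3),
      ← mul_assoc s3, s3_s4_braid]
    simp only [mul_assoc]
  have h' := (SemiconjBy.mul_left (show SemiconjBy δ3 s4 s4 from commute_δ3_s4) h).pow_right n
  simpa only [mul_assoc] using h'.eq.symm

theorem δ3_pow_three_mul_add_one (k : ℕ) : δ3 ^ (3 * k + 1) = Δ3 ^ (2 * k) * δ3 := by
  rw [pow_succ, pow_mul, δ3_pow_three, pow_mul]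

/-- `T_k` as a product of the first factor of the conjugator with a remainder. -/
theorem T_succ_eq (n : ℕ) :
    T (n + 1) = (Δ3 * s4) ^ (2 * (n + 1)) * ((δ3 * s4 * s3 * s4) * (s3 * s4 ^ (2 * n))) := by
  have h₁ : s4 * (δ3 * s4 * s3 * s4) = δ3 * s4 * s3 * s4 * s3 := by
    simpa using s4_pow_mul_s4_s3_s4 1
  have h₂ : 2 * (n + 1) - 1 = 1 + 2 * n := by omega
  rw [T, h₂, δ3_pow_three_mul_add_one, commute_Δ3_s4.mul_pow, pow_add s4 _ 2, pow_add s4 1,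
    pow_one, ← mul_assoc (δ3 * s4 * s3 * s4), ← h₁, mul_assoc _ δ3, ← mul_assoc δ3,
    (commute_δ3_s4.pow_right (2 * (n + 1))).eq, ← mul_assoc s4 (δ3 * s4 * s3),
    ← mul_assoc s4 (δ3 * s4), ← mul_assoc s4 δ3, ← commute_δ3_s4.eq, sq]
  simp only [mul_assoc]

theorem T'_succ_eq (n : ℕ) :
    T' (n + 1) = s3 ^ (2 * n) * (s3 * s4 * Δ3) * (Δ3 * s4) ^ (2 * n + 1) * (δ3 * s4 * s3 * s4) := by
  have h₁ : 2 * (n + 1) - 2 = 2 * n := by omega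
  have c₁ : Commute (s1 ^ (2 * n)) (s3 ^ (2 * n) * (s3 * s4)) :=
    (commute_s1_s3.pow_pow _ _).mul_right
      ((commute_s1_s3.mul_right commute_s1_s4).pow_left _)
  have c₂ : Commute (s1 ^ (2 * n)) (Δ3 * Δ3 * s4) := by
    rw [← sq]
    exact (commute_s1_Δ3_sq.mul_right commute_s1_s4).pow_left _
  have c₃ : Commute (Δ3 ^ (2 * n)) s4 := commute_Δ3_s4.pow_left _
  calc T' (n + 1)
      = (s1 ^ (2 * n) * (s3 ^ (2 * n) * (s3 * s4))) * (Δ3 * Δ3 * s4) *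
          (δ3 * δt3) ^ n * s4 ^ (2 * n) * (δ3 * s4 * s3 * s4) := by
        rw [T', h₁, Nat.add_sub_cancel, commute_s1_s3.mul_pow, δ3_mul_s4_mul_δt3_mul_s4_pow]
        simp only [mul_assoc]
    _ = s3 ^ (2 * n) * (s3 * s4) * (s1 ^ (2 * n) * (Δ3 * Δ3 * s4)) *
          (δ3 * δt3) ^ n * s4 ^ (2 * n) * (δ3 * s4 * s3 * s4) := by
        rw [c₁.eq]
        simp only [mul_assoc]
    _ = s3 ^ (2 * n) * (s3 * s4) * (Δ3 * Δ3 * s4) * (s1 ^ (2 * n) * (δ3 * δt3) ^ n) *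
          s4 ^ (2 * n) * (δ3 * s4 * s3 * s4) := by
        rw [c₂.eq]
        simp only [mul_assoc]
    _ = _ := by
        rw [s1_pow_mul_δ3_mul_δt3_pow, pow_succ', commute_Δ3_s4.mul_pow]
        simp only [mul_assoc]

/-- conjugating `T_k` by
`τ = (Δ₃σ₄)^{2k}(δ₃σ₄σ₃σ₄)(σ₃σ₄Δ₃)(Δ₃σ₄)^{2k-1}(δ₃σ₄σ₃σ₄)` yields `T'_k`;
in particular `T_k` and `T'_k` are conjugate. -/
theorem Tk_conj_T'k (k : ℕ) (hk : 2 ≤ k) :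
    ((Δ3*s4)^(2*k) * (δ3*s4*s3*s4) * (s3*s4*Δ3) * (Δ3*s4)^(2*k-1) * (δ3*s4*s3*s4))⁻¹ *
        T k *
      ((Δ3*s4)^(2*k) * (δ3*s4*s3*s4) * (s3*s4*Δ3) * (Δ3*s4)^(2*k-1) * (δ3*s4*s3*s4)) =
      T' k ∧
    IsConj (T k) (T' k) := by
  obtain ⟨n, rfl⟩ : ∃ n, k = n + 1 := ⟨k - 1, by omega⟩
  have hτ : T (n + 1) * ((Δ3*s4)^(2*(n+1)) * (δ3*s4*s3*s4) * (s3*s4*Δ3) * (Δ3*s4)^(2*(n+1)-1) *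
      (δ3*s4*s3*s4)) =
      ((Δ3*s4)^(2*(n+1)) * (δ3*s4*s3*s4) * (s3*s4*Δ3) * (Δ3*s4)^(2*(n+1)-1) *
        (δ3*s4*s3*s4)) * T' (n + 1) := by
    have h₁ : 2 * (n + 1) - 1 = 2 * n + 1 := by omega
    have c : Commute (s4 ^ (2 * n)) (s4 * Δ3 * (Δ3 * s4) ^ (2 * n + 1)) := by
      have c₀ : Commute s4 Δ3 := commute_Δ3_s4.symm
      exact (((Commute.refl s4).mul_right c₀).mul_right
        ((c₀.mul_right (Commute.refl s4)).pow_right _)).pow_left _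
    have e : (Δ3 * s4) ^ (2 * (n + 1)) = s4 * Δ3 * (Δ3 * s4) ^ (2 * n + 1) := by
      rw [← commute_Δ3_s4.eq, ← pow_succ']
      rfl
    have hc : s4 ^ (2 * n) * (Δ3 * s4) ^ (2 * (n + 1)) =
        s4 * Δ3 * (Δ3 * s4) ^ (2 * n + 1) * s4 ^ (2 * n) := by
      rw [e]
      exact c.eq
    generalize hB : δ3 * s4 * s3 * s4 = B
    have hs := s4_pow_mul_s4_s3_s4 (2 * n)
    rw [hB] at hs
    rw [T_succ_eq, T'_succ_eq, h₁, hB]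
    calc _ = (Δ3 * s4) ^ (2 * (n + 1)) * B * s3 * (s4 ^ (2 * n) * (Δ3 * s4) ^ (2 * (n + 1))) * B *
            (s3 * s4 * Δ3) * (Δ3 * s4) ^ (2 * n + 1) * B := by simp only [mul_assoc]
      _ = (Δ3 * s4) ^ (2 * (n + 1)) * B * s3 * (s4 * Δ3 * (Δ3 * s4) ^ (2 * n + 1)) *
            (s4 ^ (2 * n) * B) * (s3 * s4 * Δ3) * (Δ3 * s4) ^ (2 * n + 1) * B := by
          rw [hc]
          simp only [mul_assoc]
      _ = _ := by
          rw [hs]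
          simp only [mul_assoc]
  have h := inv_mul_eq_of_eq_mul hτ
  rw [← mul_assoc] at h
  refine ⟨h, ?_⟩
  rw [← h]
  exact isConj_iff.2 ⟨_, by rw [inv_inv]⟩
end

section
/- Let k ≥ 2 and let T'_k = (σ₁σ₃)^{2k−2}(σ₃σ₄Δ₃)(Δ₃σ₄)[(δ₃σ₄)(δ̃₃σ₄)]^{k−1}(δ₃σ₄σ₃σ₄) ∈ B₅. Then each of the factors σ₁σ₃ (appearing 2k−2 times), σ₃σ₄Δ₃, Δ₃σ₄, δ₃σ₄, δ̃₃σ₄, and δ₃σ₄σ₃σ₄ is a simple braid distinct from 1 and from Δ; every pair of consecutive factors in this product is left-weighted; and moreover the pair (δ₃σ₄σ₃σ₄, σ₁σ₃) consisting of the final factor followed by the initial factor is also left-weighted (i.e. T'_k is rigid). -/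
open Equiv in
/-- The adjacent transposition of `Fin 5` underlying `gen i`. -/
def adjSwap (i : Fin 4) : Perm (Fin 5) := swap i.castSucc i.succ

theorem braidRels_adjSwap : ∀ r ∈ braidRels, FreeGroup.lift adjSwap r = 1 := by
  rintro r (⟨i, rfl⟩ | ⟨i, j, hij, rfl⟩)
  · simp only [map_mul, map_inv, FreeGroup.lift_apply_of]
    revert i
    decide
  · simp only [map_mul, map_inv, FreeGroup.lift_apply_of]
    revert i j
    decide

theorem braidRels_exponentSum :
    ∀ r ∈ braidRels, FreeGroup.lift (fun _ : Fin 4 => Multiplicative.ofAdd (1 : ℤ)) r = 1 := by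
  rintro r (⟨i, rfl⟩ | ⟨i, j, hij, rfl⟩) <;> simp

/-- The permutation underlying a braid. -/
def toPerm : B5 →* Equiv.Perm (Fin 5) := PresentedGroup.toGroup braidRels_adjSwap

/-- The exponent sum of a braid. -/
def exponentSum : B5 →* Multiplicative ℤ := PresentedGroup.toGroup braidRels_exponentSum

@[simp]
theorem toPerm_gen (i : Fin 4) : toPerm (gen i) = adjSwap i :=
  PresentedGroup.toGroup.of braidRels_adjSwap

@[simp]
theorem exponentSum_gen (i : Fin 4) : exponentSum (gen i) = Multiplicative.ofAdd 1 :=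
  PresentedGroup.toGroup.of braidRels_exponentSum

/-- The number of inversions of a permutation. -/
def inversions (p : Equiv.Perm (Fin 5)) : ℕ :=
  (Finset.univ.filter fun x : Fin 5 × Fin 5 => x.1 < x.2 ∧ p x.2 < p x.1).card

theorem adjSwap_lt_adjSwap : ∀ (i : Fin 4) (a b : Fin 5), a < b → (a, b) ≠ (i.castSucc, i.succ) →
    adjSwap i a < adjSwap i b := by
  decide

theorem inversions_mul_adjSwap_le (p : Equiv.Perm (Fin 5)) (i : Fin 4) :
    inversions (p * adjSwap i) ≤ inversions p + 1 := by
  unfold inversions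
  set f := ((adjSwap i).prodCongr (adjSwap i)).toEmbedding
  set s := Finset.univ.filter fun x : Fin 5 × Fin 5 =>
    x.1 < x.2 ∧ (p * adjSwap i) x.2 < (p * adjSwap i) x.1
  refine Nat.sub_le_iff_le_add.1 ((Finset.pred_card_le_card_erase (s := s)
    (a := (i.castSucc, i.succ))).trans ?_)
  rw [← Finset.card_map f]
  refine Finset.card_le_card fun y hy => ?_
  obtain ⟨⟨a, b⟩, hab, rfl⟩ := Finset.mem_map.1 hy
  obtain ⟨hne, hab⟩ := Finset.mem_erase.1 hab
  obtain ⟨hlt, hinv⟩ := (Finset.mem_filter.1 hab).2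
  exact Finset.mem_filter.2 ⟨Finset.mem_univ _, adjSwap_lt_adjSwap i a b hlt hne, hinv⟩

theorem IsPos.inversions_mul_le (p : Equiv.Perm (Fin 5)) {y : B5} (hy : IsPos y) :
    (inversions (p * toPerm y) : ℤ) ≤ inversions p + (exponentSum y).toAdd := by
  induction hy using Submonoid.closure_induction_right with
  | one => simp
  | mul_right x hx y hy ih =>
    obtain ⟨i, rfl⟩ := hy
    have := inversions_mul_adjSwap_le (p * toPerm x) i
    simp only [map_mul, toPerm_gen, exponentSum_gen, toAdd_mul, toAdd_ofAdd, ← mul_assoc]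
    omega

/-- The braid represented by a positive word. -/
def word (l : List (Fin 4)) : B5 := (l.map gen).prod

theorem isPos_word (l : List (Fin 4)) : IsPos (word l) := by
  refine Submonoid.list_prod_mem _ fun x hx => ?_
  obtain ⟨i, -, rfl⟩ := List.mem_map.1 hx
  exact Submonoid.subset_closure ⟨i, rfl⟩

theorem toPerm_word (l : List (Fin 4)) : toPerm (word l) = (l.map adjSwap).prod := by
  induction l with
  | nil => simp [word]
  | cons i l ih => simpa [word] using ih

theorem exponentSum_word (l : List (Fin 4)) : (exponentSum (word l)).toAdd = l.length := by
  induction l with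
  | nil => simp [word]
  | cons i l ih =>
    have h : word (i :: l) = gen i * word l := by simp [word]
    simp [h, ih, add_comm]

theorem Δ_eq_word : Δ = word [0, 1, 2, 3, 0, 1, 2, 0, 1, 0] := by
  simp [Δ, word, s1, s2, s3, s4, mul_assoc]

theorem inversions_toPerm_Δ : inversions (toPerm Δ) = 10 := by
  rw [Δ_eq_word, toPerm_word]
  decide

theorem exponentSum_Δ : (exponentSum Δ).toAdd = 10 := by
  rw [Δ_eq_word, exponentSum_word]
  rfl

theorem IsSimple.inversions_toPerm {s : B5} (hs : IsSimple s) :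
    (inversions (toPerm s) : ℤ) = (exponentSum s).toAdd := by
  have h₁ := hs.1.inversions_mul_le 1
  have h₂ := IsPos.inversions_mul_le (toPerm s) hs.2
  have h₃ : inversions 1 = 0 := by decide
  rw [← map_mul, mul_inv_cancel_left, inversions_toPerm_Δ, map_mul, map_inv, toAdd_mul, toAdd_inv,
    exponentSum_Δ] at h₂
  rw [one_mul, h₃] at h₁
  push_cast at h₁ h₂
  omega

theorem leftWeighted_word (l m : List (Fin 4))
    (h : ∀ i, inversions ((l.map adjSwap).prod * adjSwap i) ≠ l.length + 1 ∨
      inversions ((adjSwap i)⁻¹ * (m.map adjSwap).prod) + 1 ≠ m.length) :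
    LeftWeighted (word l) (word m) := by
  rintro ⟨i, hl, hm⟩
  have hl := hl.inversions_toPerm
  have hm := hm.inversions_toPerm
  simp only [map_mul, map_inv, toPerm_gen, toPerm_word, exponentSum_gen, toAdd_mul, toAdd_inv,
    toAdd_ofAdd, exponentSum_word] at hl hm
  have := h i
  omega

theorem gen_braid (i : Fin 3) :
    gen i.castSucc * gen i.succ * gen i.castSucc = gen i.succ * gen i.castSucc * gen i.succ :=
  PresentedGroup.mk_eq_mk_of_mul_inv_mem (Or.inl ⟨i, rfl⟩)

theorem gen_comm (i j : Fin 4) (h : 2 ≤ |(i : ℤ) - (j : ℤ)|) : gen i * gen j = gen j * gen i :=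
  PresentedGroup.mk_eq_mk_of_mul_inv_mem (Or.inr ⟨i, j, h, rfl⟩)

theorem isSimple_of_word_mul_word {l m : List (Fin 4)} (h : word l * word m = Δ) :
    IsSimple (word l) := by
  refine ⟨isPos_word l, ?_⟩
  rw [Pre, ← h, inv_mul_cancel_left]
  exact isPos_word m

theorem word_ne_one_and_ne_Δ {l : List (Fin 4)} (h₀ : l.length ≠ 0) (h₁ : l.length ≠ 10) :
    word l ≠ 1 ∧ word l ≠ Δ := by
  constructor <;> intro h <;> have h := congrArg (fun x => (exponentSum x).toAdd) h
  · simp only [exponentSum_word, map_one, toAdd_one] at h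
    omega
  · simp only [exponentSum_word, exponentSum_Δ] at h
    omega

theorem isSimple_word_of_mem {l : List (Fin 4)}
    (hl : l ∈ [[0, 2], [2, 3, 1, 0, 1], [1, 0, 1, 3], [1, 0, 3], [0, 1, 3], [1, 0, 3, 2, 3]]) :
    IsSimple (word l) := by
  have comm20 (x : B5) : gen 2 * (gen 0 * x) = gen 0 * (gen 2 * x) := by
    rw [← mul_assoc, gen_comm 2 0 (by decide), mul_assoc]
  have comm30 (x : B5) : gen 3 * (gen 0 * x) = gen 0 * (gen 3 * x) := by
    rw [← mul_assoc, gen_comm 3 0 (by decide), mul_assoc]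
  have comm31 (x : B5) : gen 3 * (gen 1 * x) = gen 1 * (gen 3 * x) := by
    rw [← mul_assoc, gen_comm 3 1 (by decide), mul_assoc]
  have braid10 (x : B5) : gen 1 * (gen 0 * (gen 1 * x)) = gen 0 * (gen 1 * (gen 0 * x)) := by
    have h : gen 1 * gen 0 * gen 1 = gen 0 * gen 1 * gen 0 := (gen_braid 0).symm
    simpa only [mul_assoc] using congrArg (· * x) h
  have braid21 (x : B5) : gen 2 * (gen 1 * (gen 2 * x)) = gen 1 * (gen 2 * (gen 1 * x)) := by
    have h : gen 2 * gen 1 * gen 2 = gen 1 * gen 2 * gen 1 := (gen_braid 1).symm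
    simpa only [mul_assoc] using congrArg (· * x) h
  have braid32 (x : B5) : gen 3 * (gen 2 * (gen 3 * x)) = gen 2 * (gen 3 * (gen 2 * x)) := by
    have h : gen 3 * gen 2 * gen 3 = gen 2 * gen 3 * gen 2 := (gen_braid 2).symm
    simpa only [mul_assoc] using congrArg (· * x) h
  have braid210 (x : B5) : gen 2 * (gen 1 * (gen 0 * (gen 2 * x))) =
      gen 1 * (gen 2 * (gen 1 * (gen 0 * x))) := by
    rw [← comm20, braid21]
  have braid321 (x : B5) : gen 3 * (gen 2 * (gen 1 * (gen 3 * x))) =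
      gen 2 * (gen 3 * (gen 2 * (gen 1 * x))) := by
    rw [← comm31, braid32]
  have braid3210 (x : B5) : gen 3 * (gen 2 * (gen 1 * (gen 0 * (gen 3 * x)))) =
      gen 2 * (gen 3 * (gen 2 * (gen 1 * (gen 0 * x)))) := by
    rw [← comm30, braid321]
  have key {l : List (Fin 4)} (m : List (Fin 4)) (h : ∀ x, word l * (word m * x) = Δ * x) :
      IsSimple (word l) :=
    isSimple_of_word_mul_word (m := m) (by simpa using h 1)
  simp only [List.mem_cons, List.not_mem_nil, or_false] at hl
  rcases hl with rfl | rfl | rfl | rfl | rfl | rfl <;>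
    [refine key [1, 0, 2, 1, 3, 2, 1, 0] ?_; refine key [2, 1, 0, 3, 2] ?_;
      refine key [2, 1, 0, 3, 2, 1] ?_; refine key [1, 2, 1, 0, 3, 2, 1] ?_;
      refine key [0, 2, 1, 0, 3, 2, 1] ?_; refine key [1, 0, 2, 1, 3] ?_] <;>
    intro x <;>
    simp only [Δ_eq_word, word, List.map_cons, List.map_nil, List.prod_cons, List.prod_nil, one_mul,
      mul_assoc, comm20, comm30, comm31, braid10, braid32, braid210, braid3210]

theorem isChain_replicate_append {α : Type*} {R : α → α → Prop} {a b : α} {l : List α}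
    (haa : R a a) (hab : R a b) (hl : List.IsChain R (b :: l)) (n : ℕ) :
    List.IsChain R (List.replicate n a ++ b :: l) := by
  induction n with
  | zero => simpa using hl
  | succ n ih =>
    cases n with
    | zero => simpa using ⟨hab, hl⟩
    | succ n =>
      simp only [List.replicate_succ, List.cons_append, List.isChain_cons_cons] at ih ⊢
      exact ⟨haa, ih⟩

theorem isChain_cons_flatten_replicate_append {α : Type*} {R : α → α → Prop} {a b c x : α}
    (hab : R a b) (hba : R b a) (hbc : R b c) (hxa : R x a) (hxc : R x c) (n : ℕ) :
    List.IsChain R (x :: ((List.replicate n [a, b]).flatten ++ [c])) := by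
  induction n generalizing x with
  | zero => simpa using hxc
  | succ n ih =>
    simp only [List.replicate_succ, List.flatten_cons, List.cons_append, List.nil_append,
      List.isChain_cons_cons]
    exact ⟨hxa, hab, ih hba hbc⟩

/-- the displayed factorization of `T'_k` is its left normal form:
each factor is simple, distinct from `1` and `Δ`, consecutive factors are
left-weighted, and moreover the final factor followed by the initial factor is
left-weighted, i.e. `T'_k` is rigid. -/
theorem T'k_rigid_normal_form (k : ℕ) (hk : 2 ≤ k) :
    T' k = (List.replicate (2*k-2) (s1*s3) ++ [s3*s4*Δ3, Δ3*s4] ++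
        (List.replicate (k-1) [δ3*s4, δt3*s4]).flatten ++ [δ3*s4*s3*s4]).prod ∧
    (∀ f ∈ List.replicate (2*k-2) (s1*s3) ++ [s3*s4*Δ3, Δ3*s4] ++
        (List.replicate (k-1) [δ3*s4, δt3*s4]).flatten ++ [δ3*s4*s3*s4],
      IsSimple f ∧ f ≠ 1 ∧ f ≠ Δ) ∧
    List.Chain' LeftWeighted (List.replicate (2*k-2) (s1*s3) ++ [s3*s4*Δ3, Δ3*s4] ++
        (List.replicate (k-1) [δ3*s4, δt3*s4]).flatten ++ [δ3*s4*s3*s4]) ∧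
    LeftWeighted (δ3*s4*s3*s4) (s1*s3) := by
  have e₁ : s1 * s3 = word [0, 2] := by simp [word, s1, s3]
  have e₂ : s3 * s4 * Δ3 = word [2, 3, 1, 0, 1] := by simp [word, Δ3, s1, s2, s3, s4, mul_assoc]
  have e₃ : Δ3 * s4 = word [1, 0, 1, 3] := by simp [word, Δ3, s1, s2, s4, mul_assoc]
  have e₄ : δ3 * s4 = word [1, 0, 3] := by simp [word, δ3, s1, s2, s4, mul_assoc]
  have e₅ : δt3 * s4 = word [0, 1, 3] := by simp [word, δt3, s1, s2, s4, mul_assoc]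
  have e₆ : δ3 * s4 * s3 * s4 = word [1, 0, 3, 2, 3] := by
    simp [word, δ3, s1, s2, s3, s4, mul_assoc]
  refine ⟨?_, ?_, ?_, ?_⟩
  · simp [T', List.prod_flatten, mul_assoc]
  · rw [e₆, e₁, e₂, e₃, e₄, e₅]
    intro f hf
    replace hf : ∃ l ∈ [[0, 2], [2, 3, 1, 0, 1], [1, 0, 1, 3], [1, 0, 3], [0, 1, 3], [1, 0, 3, 2, 3]],
        f = word l := by
      simp only [List.mem_append, List.mem_replicate, List.mem_flatten, List.mem_cons,
        List.not_mem_nil, or_false] at hf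
      rcases hf with ((⟨-, rfl⟩ | rfl | rfl) | ⟨_, ⟨-, rfl⟩, hf⟩) | rfl
      on_goal 4 =>
        simp only [List.mem_cons, List.not_mem_nil, or_false] at hf
        rcases hf with rfl | rfl
      all_goals exact ⟨_, by decide, rfl⟩
    obtain ⟨l, hl, rfl⟩ := hf
    refine ⟨isSimple_word_of_mem hl, word_ne_one_and_ne_Δ ?_ ?_⟩ <;>
      revert l <;> decide
  · rw [e₆, e₁, e₂, e₃, e₄, e₅]
    change List.IsChain _ _
    simp only [List.append_assoc, List.cons_append, List.nil_append]
    refine isChain_replicate_append (leftWeighted_word _ _ (by decide))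
      (leftWeighted_word _ _ (by decide)) (List.isChain_cons_cons.2
        ⟨leftWeighted_word _ _ (by decide), isChain_cons_flatten_replicate_append ?_ ?_ ?_ ?_ ?_ _⟩) _
    all_goals exact leftWeighted_word _ _ (by decide)
  · rw [e₁, e₆]
    exact leftWeighted_word _ _ (by decide)
end
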